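/- Let ε > 0 and let u_ε be a solution of the vectorial Allen–Cahn system on the unit disk D². Then for every radius 0 < r < 1, (1/ε)·∫_{D²(r)} V(u_ε) dx ≤ (r/2)·∫_{∂D²(r)} e_ε(u_ε) dℓ, where dℓ is arclength on the circle ∂D²(r). -/

import Mathlib

open MeasureTheory Metric Filter Topology Bornology
open scoped RealInnerProductSpace ENNReal Topology

noncomputable section

/-- The euclidean plane. -/
abbrev E2 : Type := EuclideanSpace ℝ (Fin 2)

/-- The euclidean space `ℝ^k`. -/
abbrev Evec (k : ℕ) : Type := EuclideanSpace ℝ (Fin k)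

/-- The `i`-th standard basis vector of the plane. -/
def b2 (i : Fin 2) : E2 := EuclideanSpace.single i (1 : ℝ)

/-- The partial derivative of `u` in the `i`-th coordinate direction. -/
def pder {k : ℕ} (u : E2 → Evec k) (i : Fin 2) (x : E2) : Evec k :=
  fderiv ℝ u x (b2 i)

/-- The Laplacian of a map defined on the plane. -/
def lap {k : ℕ} (u : E2 → Evec k) (x : E2) : Evec k :=
  ∑ i : Fin 2, fderiv ℝ (pder u i) x (b2 i)

/-- `u` is a smooth solution of the vectorial Allen-Cahn system
`Δu = ε⁻² ∇V(u)` on the open set `U`. -/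
def IsSolution {k : ℕ} (V : Evec k → ℝ) (ε : ℝ) (U : Set E2) (u : E2 → Evec k) : Prop :=
  ContDiffOn ℝ (⊤ : ℕ∞) u U ∧ ∀ x ∈ U, lap u x = (ε ^ 2)⁻¹ • gradient V (u x)

/-- The squared modulus `|∇u|²` of the full gradient. -/
def gradSq {k : ℕ} (u : E2 → Evec k) (x : E2) : ℝ :=
  ∑ i : Fin 2, ‖pder u i x‖ ^ 2

/-- The energy density `e_ε(u) = (ε/2)|∇u|² + ε⁻¹ V(u)`. -/
def eDens {k : ℕ} (V : Evec k → ℝ) (ε : ℝ) (u : E2 → Evec k) (x : E2) : ℝ :=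
  ε / 2 * gradSq u x + ε⁻¹ * V (u x)

/-- The energy `E_ε(u, G)`. -/
def energy {k : ℕ} (V : Evec k → ℝ) (ε : ℝ) (u : E2 → Evec k) (G : Set E2) : ℝ :=
  ∫ x in G, eDens V ε u x

/-- The hypotheses (H₁), (H₂), (H₃) on the multi-well potential `V`:
smooth, nonnegative with `inf V = 0`, finitely many zeros (at least two),
positive definite Hessian at each zero, quadratic growth of `y·∇V(y)` at
infinity and coercivity. -/
structure IsMultiWell {k : ℕ} (V : Evec k → ℝ) : Prop where
  smooth : ContDiff ℝ (⊤ : ℕ∞) V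
  nonneg : ∀ y, 0 ≤ V y
  finite_zeros : {y : Evec k | V y = 0}.Finite
  two_le_card : 2 ≤ {y : Evec k | V y = 0}.ncard
  hess_posdef : ∀ σ : Evec k, V σ = 0 → ∀ w : Evec k, w ≠ 0 →
    0 < iteratedFDeriv ℝ 2 V σ ![w, w]
  growth : ∃ α > (0 : ℝ), ∃ R > (0 : ℝ), ∀ y : Evec k, R < ‖y‖ →
    α * ‖y‖ ^ 2 ≤ ⟪y, gradient V y⟫
  coercive : ∀ C : ℝ, ∃ R : ℝ, ∀ y : Evec k, R ≤ ‖y‖ → C ≤ V y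

/-- The point of the plane with coordinates `(a, b)`. -/
def vec2 (a b : ℝ) : E2 :=
  EuclideanSpace.single (0 : Fin 2) a + EuclideanSpace.single (1 : Fin 2) b

/-- The point of the circle of center `x₀` and radius `r` at angle `θ`. -/
def circPt (x₀ : E2) (r θ : ℝ) : E2 := x₀ + vec2 (r * Real.cos θ) (r * Real.sin θ)

/-- The outward unit normal vector of a circle at angle `θ`. -/
def norv (θ : ℝ) : E2 := vec2 (Real.cos θ) (Real.sin θ)

/-- The unit tangent vector of a circle at angle `θ`. -/
def tanv (θ : ℝ) : E2 := vec2 (-Real.sin θ) (Real.cos θ)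

lemma vec2_apply_zero (a b : ℝ) : vec2 a b 0 = a := by simp [vec2]

lemma vec2_apply_one (a b : ℝ) : vec2 a b 1 = b := by simp [vec2]

lemma vec2_eq_smul (a b : ℝ) : vec2 a b = a • b2 0 + b • b2 1 := by
  ext i
  fin_cases i <;> simp [vec2, b2]

lemma norm_vec2_sq (a b : ℝ) : ‖vec2 a b‖ ^ 2 = a ^ 2 + b ^ 2 := by
  rw [EuclideanSpace.real_norm_sq_eq, Fin.sum_univ_two, vec2_apply_zero, vec2_apply_one]

lemma norm_circPt_zero (ρ θ : ℝ) : ‖circPt 0 ρ θ‖ = |ρ| := by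
  rw [← sq_eq_sq₀ (norm_nonneg _) (abs_nonneg _), circPt, zero_add, norm_vec2_sq, sq_abs]
  linear_combination ρ ^ 2 * Real.sin_sq_add_cos_sq θ

lemma continuous_circPt (x₀ : E2) : Continuous fun p : ℝ × ℝ => circPt x₀ p.1 p.2 := by
  simp only [circPt, vec2_eq_smul]
  fun_prop

/-- The identification of `ℝ × ℝ` with the Euclidean plane. -/
def vec2Equiv : ℝ × ℝ ≃ᵐ E2 :=
  (MeasurableEquiv.finTwoArrow (α := ℝ)).symm.trans (MeasurableEquiv.toLp 2 (Fin 2 → ℝ))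

lemma vec2Equiv_apply (p : ℝ × ℝ) : vec2Equiv p = vec2 p.1 p.2 := by
  ext i
  fin_cases i <;> simp [vec2, vec2Equiv, MeasurableEquiv.finTwoArrow]

lemma measurePreserving_vec2Equiv : MeasurePreserving vec2Equiv :=
  (volume_preserving_finTwoArrow ℝ).symm.trans
    (EuclideanSpace.volume_preserving_symm_measurableEquiv_toLp (Fin 2)).symm

lemma setIntegral_Ioo_prod_Ioo (h : ℝ × ℝ → ℝ) {a₁ b₁ a₂ b₂ : ℝ} (h₁ : a₁ ≤ b₁) (h₂ : a₂ ≤ b₂)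
    (hh : ContinuousOn h (Set.Icc a₁ b₁ ×ˢ Set.Icc a₂ b₂)) :
    ∫ p in Set.Ioo a₁ b₁ ×ˢ Set.Ioo a₂ b₂, h p = ∫ x in a₁..b₁, ∫ y in a₂..b₂, h (x, y) := by
  have hint : IntegrableOn h (Set.Ioo a₁ b₁ ×ˢ Set.Ioo a₂ b₂) :=
    (hh.integrableOn_compact (isCompact_Icc.prod isCompact_Icc)).mono_set
      (Set.prod_mono Set.Ioo_subset_Icc_self Set.Ioo_subset_Icc_self)
  rw [Measure.volume_eq_prod] at hint ⊢
  rw [setIntegral_prod h hint]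
  simp only [intervalIntegral.integral_of_le h₁, intervalIntegral.integral_of_le h₂,
    integral_Ioc_eq_integral_Ioo]

/-- Integration over a disk in polar coordinates. -/
lemma setIntegral_ball_eq_polar (g : E2 → ℝ) {r : ℝ} (hr : 0 < r)
    (hg : ContinuousOn g (closedBall 0 r)) :
    ∫ x in ball (0 : E2) r, g x =
      ∫ ρ in (0 : ℝ)..r, ∫ θ in (-Real.pi)..Real.pi, ρ * g (circPt 0 ρ θ) := by
  have hmaps : Set.MapsTo (fun p : ℝ × ℝ => circPt 0 p.1 p.2)
      (Set.Icc 0 r ×ˢ Set.Icc (-Real.pi) Real.pi) (closedBall 0 r) := by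
    rintro ⟨ρ, θ⟩ ⟨⟨h0, h1⟩, -⟩
    rw [mem_closedBall_zero_iff, norm_circPt_zero, abs_of_nonneg h0]
    exact h1
  have hcont : ContinuousOn (fun p : ℝ × ℝ => p.1 * g (circPt 0 p.1 p.2))
      (Set.Icc 0 r ×ˢ Set.Icc (-Real.pi) Real.pi) :=
    continuousOn_fst.mul (hg.comp (continuous_circPt 0).continuousOn hmaps)
  rw [← setIntegral_Ioo_prod_Ioo _ hr.le (by linarith [Real.pi_pos]) hcont,
    ← integral_indicator measurableSet_ball,
    ← measurePreserving_vec2Equiv.integral_comp vec2Equiv.measurableEmbedding,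
    ← integral_comp_polarCoord_symm, polarCoord_target,
    ← integral_indicator (measurableSet_Ioi.prod measurableSet_Ioo),
    ← integral_indicator (measurableSet_Ioo.prod measurableSet_Ioo)]
  congr 1
  ext ⟨ρ, θ⟩
  have hc : vec2Equiv (polarCoord.symm (ρ, θ)) = circPt 0 ρ θ := by
    rw [vec2Equiv_apply, polarCoord_symm_apply, circPt, zero_add]
  simp only [Set.indicator_apply, Set.mem_prod, Set.mem_Ioi, Set.mem_Ioo, hc, smul_eq_mul]
  by_cases h0 : 0 < ρ
  · by_cases h1 : ρ < r <;>
      simp [norm_circPt_zero, abs_of_pos h0, h0, h1]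
  · simp [h0]

lemma hasFDerivAt_circPt (x₀ : E2) (p : ℝ × ℝ) :
    ∃ L : ℝ × ℝ →L[ℝ] E2, HasFDerivAt (fun p : ℝ × ℝ => circPt x₀ p.1 p.2) L p ∧
      L (1, 0) = norv p.2 ∧ L (0, 1) = p.1 • tanv p.2 := by
  have hd : Differentiable ℝ (fun p : ℝ × ℝ => circPt x₀ p.1 p.2) := by
    simp only [circPt, vec2_eq_smul]
    fun_prop
  refine ⟨_, (hd p).hasFDerivAt, ?_, ?_⟩
  · have h1 : HasDerivAt (fun t : ℝ => (t, p.2)) ((1 : ℝ), (0 : ℝ)) p.1 :=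
      (hasDerivAt_id p.1).prodMk (hasDerivAt_const _ _)
    have h2 := HasFDerivAt.comp_hasDerivAt p.1 (hd p).hasFDerivAt h1
    refine h2.unique ?_
    simp only [circPt, vec2_eq_smul, norv, Function.comp_def]
    have := (((hasDerivAt_id p.1).mul_const (Real.cos p.2)).smul_const (b2 0)).add
      (((hasDerivAt_id p.1).mul_const (Real.sin p.2)).smul_const (b2 1))
    simpa using this.const_add x₀
  · have h1 : HasDerivAt (fun t : ℝ => (p.1, t)) ((0 : ℝ), (1 : ℝ)) p.2 :=
      (hasDerivAt_const _ _).prodMk (hasDerivAt_id p.2)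
    have h2 := HasFDerivAt.comp_hasDerivAt p.2 (hd p).hasFDerivAt h1
    refine h2.unique ?_
    simp only [circPt, vec2_eq_smul, tanv, Function.comp_def]
    have := (((Real.hasDerivAt_cos p.2).const_mul p.1).smul_const (b2 0)).add
      (((Real.hasDerivAt_sin p.2).const_mul p.1).smul_const (b2 1))
    simpa [mul_smul, smul_add] using this.const_add x₀

/-- The divergence theorem on a disk. -/
lemma setIntegral_ball_divergence {F₀ F₁ : E2 → ℝ} {U : Set E2} (hU : IsOpen U)
    {r : ℝ} (hr : 0 < r) (hrU : closedBall 0 r ⊆ U)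
    (h₀ : ContDiffOn ℝ 1 F₀ U) (h₁ : ContDiffOn ℝ 1 F₁ U) :
    ∫ x in ball (0 : E2) r, (fderiv ℝ F₀ x (b2 0) + fderiv ℝ F₁ x (b2 1)) =
      ∫ θ in (-Real.pi)..Real.pi,
        r * (F₀ (circPt 0 r θ) * Real.cos θ + F₁ (circPt 0 r θ) * Real.sin θ) := by
  have hcont : ContinuousOn (fun x => fderiv ℝ F₀ x (b2 0) + fderiv ℝ F₁ x (b2 1))
      (closedBall 0 r) := by
    have := ((h₀.continuousOn_fderiv_of_isOpen hU le_rfl).clm_apply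
      (continuousOn_const (c := b2 0))).add
      ((h₁.continuousOn_fderiv_of_isOpen hU le_rfl).clm_apply (continuousOn_const (c := b2 1)))
    exact this.mono hrU
  have hmaps : Set.MapsTo (fun p : ℝ × ℝ => circPt 0 p.1 p.2)
      (Set.uIcc 0 r ×ˢ Set.uIcc (-Real.pi) Real.pi) (closedBall 0 r) := by
    rintro ⟨ρ, θ⟩ ⟨hρ, -⟩
    rw [Set.uIcc_of_le hr.le] at hρ
    rw [mem_closedBall_zero_iff, norm_circPt_zero, abs_of_nonneg hρ.1]
    exact hρ.2
  rw [setIntegral_ball_eq_polar _ hr hcont]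
  choose L hL hLn hLt using hasFDerivAt_circPt (0 : E2)
  have hF : ∀ F : E2 → ℝ, ContDiffOn ℝ 1 F U → ∀ p : ℝ × ℝ, circPt 0 p.1 p.2 ∈ U →
      HasFDerivAt (fun p : ℝ × ℝ => F (circPt 0 p.1 p.2))
        ((fderiv ℝ F (circPt 0 p.1 p.2)).comp (L p)) p := fun F hF p hp =>
    HasFDerivAt.comp p (((hF.differentiableOn one_ne_zero).differentiableAt
      (hU.mem_nhds hp)).hasFDerivAt) (hL p)
  have hcos : ∀ p : ℝ × ℝ, HasFDerivAt (fun p : ℝ × ℝ => Real.cos p.2)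
      (-Real.sin p.2 • ContinuousLinearMap.snd ℝ ℝ ℝ) p := fun p =>
    (Real.hasDerivAt_cos p.2).comp_hasFDerivAt p hasFDerivAt_snd
  have hsin : ∀ p : ℝ × ℝ, HasFDerivAt (fun p : ℝ × ℝ => Real.sin p.2)
      (Real.cos p.2 • ContinuousLinearMap.snd ℝ ℝ ℝ) p := fun p =>
    (Real.hasDerivAt_sin p.2).comp_hasFDerivAt p hasFDerivAt_snd
  set f : ℝ × ℝ → ℝ := fun p => p.1 * (F₀ (circPt 0 p.1 p.2) * Real.cos p.2 +
    F₁ (circPt 0 p.1 p.2) * Real.sin p.2) with hf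
  set g : ℝ × ℝ → ℝ := fun p => F₁ (circPt 0 p.1 p.2) * Real.cos p.2 -
    F₀ (circPt 0 p.1 p.2) * Real.sin p.2 with hg
  have hf' : ∀ p : ℝ × ℝ, circPt 0 p.1 p.2 ∈ U → HasFDerivAt f (fderiv ℝ f p) p ∧
      HasFDerivAt g (fderiv ℝ g p) p ∧ fderiv ℝ f p (1, 0) + fderiv ℝ g p (0, 1) =
        p.1 * (fderiv ℝ F₀ (circPt 0 p.1 p.2) (b2 0) +
          fderiv ℝ F₁ (circPt 0 p.1 p.2) (b2 1)) := by
    intro p hp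
    have H1 : HasFDerivAt f _ p := hasFDerivAt_fst.mul
      (((hF F₀ h₀ p hp).mul (hcos p)).add ((hF F₁ h₁ p hp).mul (hsin p)))
    have H2 : HasFDerivAt g _ p :=
      ((hF F₁ h₁ p hp).mul (hcos p)).sub ((hF F₀ h₀ p hp).mul (hsin p))
    refine ⟨H1.differentiableAt.hasFDerivAt, H2.differentiableAt.hasFDerivAt, ?_⟩
    rw [H1.fderiv, H2.fderiv]
    simp [hLn, hLt, norv, tanv, vec2_eq_smul]
    linear_combination p.1 * (fderiv ℝ F₀ (circPt 0 p.1 p.2) (b2 0) +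
          fderiv ℝ F₁ (circPt 0 p.1 p.2) (b2 1)) * Real.sin_sq_add_cos_sq p.2
  have hFc : ∀ F : E2 → ℝ, ContDiffOn ℝ 1 F U →
      ContinuousOn (fun p : ℝ × ℝ => F (circPt 0 p.1 p.2))
        (Set.uIcc 0 r ×ˢ Set.uIcc (-Real.pi) Real.pi) := fun F hF =>
    (hF.continuousOn.mono hrU).comp (continuous_circPt 0).continuousOn hmaps
  have hin : ∀ p ∈ Set.uIcc 0 r ×ˢ Set.uIcc (-Real.pi) Real.pi, circPt 0 p.1 p.2 ∈ U :=
    fun p hp => hrU (hmaps hp)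
  have hIoo : ∀ p ∈ Set.Ioo (min 0 r) (max 0 r) ×ˢ
      Set.Ioo (min (-Real.pi) Real.pi) (max (-Real.pi) Real.pi) \ (∅ : Set (ℝ × ℝ)),
      circPt 0 p.1 p.2 ∈ U := fun p hp =>
    hin p ⟨Set.Ioo_subset_Icc_self hp.1.1, Set.Ioo_subset_Icc_self hp.1.2⟩
  have hs : Continuous fun p : ℝ × ℝ => Real.sin p.2 := by fun_prop
  have hc : Continuous fun p : ℝ × ℝ => Real.cos p.2 := by fun_prop
  have key := integral2_divergence_prod_of_hasFDerivAt_off_countable f g (fderiv ℝ f)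
    (fderiv ℝ g) 0 (-Real.pi) r Real.pi ∅ Set.countable_empty
    (continuousOn_fst.mul (((hFc F₀ h₀).mul hc.continuousOn).add
      ((hFc F₁ h₁).mul hs.continuousOn)))
    (((hFc F₁ h₁).mul hc.continuousOn).sub ((hFc F₀ h₀).mul hs.continuousOn))
    (fun p hp => (hf' p (hIoo p hp)).1) (fun p hp => (hf' p (hIoo p hp)).2.1)
    (by
      refine ContinuousOn.integrableOn_compact (isCompact_uIcc.prod isCompact_uIcc) ?_
      refine ContinuousOn.congr (continuousOn_fst.mul
        (hcont.comp (continuous_circPt 0).continuousOn hmaps)) fun p hp => ?_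
      exact (hf' p (hin p hp)).2.2)
  have hper : ∀ x, g (x, Real.pi) = g (x, -Real.pi) := by
    intro x
    simp [hg, circPt]
  have hzero : ∀ y, f (0, y) = 0 := fun y => by simp [hf]
  simp only [hper, hzero, sub_self, zero_add, intervalIntegral.integral_zero, sub_zero] at key
  rw [← key]
  refine intervalIntegral.integral_congr fun ρ hρ => ?_
  refine intervalIntegral.integral_congr fun θ hθ => ?_
  exact (hf' (ρ, θ) (hin (ρ, θ) ⟨hρ, hθ⟩)).2.2.symm

/-- The `i`-th component of the stress-energy tensor of `u` applied to the position vector. -/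
def stressPos {k : ℕ} (V : Evec k → ℝ) (ε : ℝ) (u : E2 → Evec k) (i : Fin 2) (x : E2) : ℝ :=
  eDens V ε u x * x i - ε * ⟪x 0 • pder u 0 x + x 1 • pder u 1 x, pder u i x⟫

section

variable {k : ℕ} {V : Evec k → ℝ} {ε : ℝ} {U : Set E2} {u : E2 → Evec k}

lemma contDiffOn_pder (hU : IsOpen U) (hu : ContDiffOn ℝ (⊤ : ℕ∞) u U) (i : Fin 2) :
    ContDiffOn ℝ 1 (pder u i) U :=
  (hu.fderiv_of_isOpen hU (m := 1) (WithTop.coe_le_coe.2 le_top)).clm_apply contDiffOn_const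

lemma contDiffOn_eDens (hV : ContDiff ℝ (⊤ : ℕ∞) V) (hU : IsOpen U)
    (hu : ContDiffOn ℝ (⊤ : ℕ∞) u U) : ContDiffOn ℝ 1 (eDens V ε u) U := by
  have hw := contDiffOn_pder hU hu
  have hVu : ContDiffOn ℝ 1 (fun x => V (u x)) U :=
    (hV.of_le (by exact_mod_cast le_top)).comp_contDiffOn (hu.of_le (by exact_mod_cast le_top))
  have : ContDiffOn ℝ 1 (fun x => gradSq u x) U :=
    ContDiffOn.sum fun i _ => (hw i).norm_sq ℝ
  exact (contDiffOn_const.mul this).add (contDiffOn_const.mul hVu)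

lemma contDiffOn_stressPos (hV : ContDiff ℝ (⊤ : ℕ∞) V) (hU : IsOpen U)
    (hu : ContDiffOn ℝ (⊤ : ℕ∞) u U) (i : Fin 2) : ContDiffOn ℝ 1 (stressPos V ε u i) U := by
  have hw := contDiffOn_pder hU hu
  have hx : ∀ j : Fin 2, ContDiffOn ℝ 1 (fun x : E2 => x j) U := fun j =>
    (by fun_prop : ContDiff ℝ 1 fun x : E2 => x j).contDiffOn
  exact ((contDiffOn_eDens hV hU hu).mul (hx i)).sub
    (contDiffOn_const.mul ((((hx 0).smul (hw 0)).add ((hx 1).smul (hw 1))).inner ℝ (hw i)))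

lemma fderiv_pder_comm (hU : IsOpen U) (hu : ContDiffOn ℝ (⊤ : ℕ∞) u U) {x : E2} (hx : x ∈ U)
    (i j : Fin 2) : fderiv ℝ (pder u i) x (b2 j) = fderiv ℝ (pder u j) x (b2 i) := by
  have hux : ContDiffAt ℝ (⊤ : ℕ∞) u x := hu.contDiffAt (hU.mem_nhds hx)
  have hd : DifferentiableAt ℝ (fderiv ℝ u) x :=
    (hux.fderiv_right (m := 1) (WithTop.coe_le_coe.2 le_top)).differentiableAt one_ne_zero
  have h : ∀ i j : Fin 2,
      fderiv ℝ (pder u i) x (b2 j) = fderiv ℝ (fderiv ℝ u) x (b2 j) (b2 i) := by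
    intro i j
    have := (hd.hasFDerivAt.clm_apply (hasFDerivAt_const (b2 i) x)).fderiv
    change fderiv ℝ (fun y => fderiv ℝ u y (b2 i)) x (b2 j) = _
    rw [this]
    simp
  rw [h, h]
  have h2 : ((2 : ℕ∞) : WithTop ℕ∞) ≤ ((⊤ : ℕ∞) : WithTop ℕ∞) := WithTop.coe_le_coe.2 le_top
  exact (hux.isSymmSndFDerivAt (by rw [minSmoothness_of_isRCLikeNormedField]; exact h2)).eq _ _

/-- The derivative of the `i`-th component of the stress-energy field. -/
lemma fderiv_stressPos (hV : ContDiff ℝ (⊤ : ℕ∞) V) (hU : IsOpen U)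
    (hu : ContDiffOn ℝ (⊤ : ℕ∞) u U) {x : E2} (hx : x ∈ U) (i j : Fin 2) :
    fderiv ℝ (stressPos V ε u i) x (b2 j) =
      (ε * (⟪fderiv ℝ (pder u 0) x (b2 j), pder u 0 x⟫ +
          ⟪fderiv ℝ (pder u 1) x (b2 j), pder u 1 x⟫) +
        ε⁻¹ * ⟪gradient V (u x), pder u j x⟫) * x i + eDens V ε u x * b2 j i -
      ε * (⟪x 0 • pder u 0 x + x 1 • pder u 1 x, fderiv ℝ (pder u i) x (b2 j)⟫ +
        ⟪x 0 • fderiv ℝ (pder u 0) x (b2 j) + x 1 • fderiv ℝ (pder u 1) x (b2 j) +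
          pder u j x, pder u i x⟫) := by
  have hnhds := hU.mem_nhds hx
  have hline : HasDerivAt (fun t : ℝ => x + t • b2 j) (b2 j) 0 := by
    simpa using ((hasDerivAt_id (0 : ℝ)).smul_const (b2 j)).const_add x
  have along : ∀ {E : Type} [NormedAddCommGroup E] [NormedSpace ℝ E] (F : E2 → E),
      DifferentiableAt ℝ F x → HasDerivAt (fun t : ℝ => F (x + t • b2 j))
        (fderiv ℝ F x (b2 j)) 0 := by
    intro E _ _ F hF
    refine HasFDerivAt.comp_hasDerivAt (0 : ℝ) (f := fun t : ℝ => x + t • b2 j) ?_ hline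
    simpa using hF.hasFDerivAt
  have hw : ∀ l, HasDerivAt (fun t : ℝ => pder u l (x + t • b2 j))
      (fderiv ℝ (pder u l) x (b2 j)) 0 := fun l =>
    along _ (((contDiffOn_pder hU hu l).differentiableOn one_ne_zero).differentiableAt hnhds)
  have hux : HasDerivAt (fun t : ℝ => u (x + t • b2 j)) (pder u j x) 0 :=
    along _ ((hu.differentiableOn (by simp)).differentiableAt hnhds)
  have hVu : HasDerivAt (fun t : ℝ => V (u (x + t • b2 j)))
      ⟪gradient V (u x), pder u j x⟫ 0 := by
    rw [inner_gradient_left]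
    refine HasFDerivAt.comp_hasDerivAt (0 : ℝ) (f := fun t : ℝ => u (x + t • b2 j)) ?_ hux
    simpa using (hV.differentiable (by simp) (u x)).hasFDerivAt
  have hcoord : ∀ l : Fin 2, HasDerivAt (fun t : ℝ => (x + t • b2 j) l) (b2 j l) 0 := by
    intro l
    simpa using ((hasDerivAt_id (0 : ℝ)).mul_const (b2 j l)).const_add (x l)
  have hT := along (stressPos V ε u i)
    (((contDiffOn_stressPos hV hU hu i).differentiableOn one_ne_zero).differentiableAt hnhds)
  have he : HasDerivAt (fun t : ℝ => eDens V ε u (x + t • b2 j))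
      (ε * (⟪fderiv ℝ (pder u 0) x (b2 j), pder u 0 x⟫ +
          ⟪fderiv ℝ (pder u 1) x (b2 j), pder u 1 x⟫) +
        ε⁻¹ * ⟪gradient V (u x), pder u j x⟫) 0 := by
    simp only [eDens, gradSq, Fin.sum_univ_two]
    refine HasDerivAt.congr_deriv (((((hw 0).norm_sq).add ((hw 1).norm_sq)).const_mul
      (ε / 2)).add (hVu.const_mul ε⁻¹)) ?_
    simp only [zero_smul, add_zero]
    rw [real_inner_comm (pder u 0 x), real_inner_comm (pder u 1 x)]
    ring
  have hS := (he.mul (hcoord i)).sub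
    (((((hcoord 0).smul (hw 0)).add ((hcoord 1).smul (hw 1))).inner ℝ (hw i)).const_mul ε)
  refine (hT.unique hS).trans ?_
  have hsum : b2 j 0 • pder u 0 x + b2 j 1 • pder u 1 x = pder u j x := by
    fin_cases j <;> simp [b2]
  simp only [zero_smul, add_zero, Pi.add_apply, Pi.smul_apply', ← hsum, inner_add_left,
    real_inner_smul_left]
  ring

/-- The divergence of the stress-energy field of a solution. -/
lemma div_stressPos (hV : ContDiff ℝ (⊤ : ℕ∞) V) (hU : IsOpen U) (hε : ε ≠ 0)
    (hu : IsSolution V ε U u) {x : E2} (hx : x ∈ U) :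
    fderiv ℝ (stressPos V ε u 0) x (b2 0) + fderiv ℝ (stressPos V ε u 1) x (b2 1) =
      2 * ε⁻¹ * V (u x) := by
  have hlap := hu.2 x hx
  have hg : gradient V (u x) = ε ^ 2 • (fderiv ℝ (pder u 0) x (b2 0) +
      fderiv ℝ (pder u 1) x (b2 1)) := by
    rw [lap, Fin.sum_univ_two] at hlap
    rw [hlap, smul_smul, mul_inv_cancel₀ (pow_ne_zero 2 hε), one_smul]
  rw [fderiv_stressPos hV hU hu.1 hx, fderiv_stressPos hV hU hu.1 hx, hg,
    fderiv_pder_comm hU hu.1 hx 1 0]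
  simp only [eDens, gradSq, Fin.sum_univ_two, ← real_inner_self_eq_norm_sq]
  generalize fderiv ℝ (pder u 0) x (b2 0) = a
  generalize fderiv ℝ (pder u 0) x (b2 1) = b
  generalize fderiv ℝ (pder u 1) x (b2 1) = c
  generalize pder u 0 x = p
  generalize pder u 1 x = q
  simp only [inner_add_left, real_inner_smul_left, b2, PiLp.single_apply]
  rw [real_inner_comm p a, real_inner_comm p b, real_inner_comm p c,
    real_inner_comm q a, real_inner_comm q b, real_inner_comm q c]
  simp
  field_simp
  ring

/-- The normal component of the stress-energy field on a circle is at most `r e_ε(u)`. -/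
lemma stressPos_normal_le (hε : 0 ≤ ε) {r : ℝ} (hr : 0 ≤ r) (θ : ℝ) :
    stressPos V ε u 0 (circPt 0 r θ) * Real.cos θ +
      stressPos V ε u 1 (circPt 0 r θ) * Real.sin θ ≤ eDens V ε u (circPt 0 r θ) * r := by
  have h0 : circPt 0 r θ 0 = r * Real.cos θ := by simp [circPt, vec2_apply_zero]
  have h1 : circPt 0 r θ 1 = r * Real.sin θ := by simp [circPt, vec2_apply_one]
  simp only [stressPos, h0, h1]
  generalize eDens V ε u (circPt 0 r θ) = e
  generalize pder u 0 (circPt 0 r θ) = p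
  generalize pder u 1 (circPt 0 r θ) = q
  have hn : 0 ≤ ε * r * ⟪Real.cos θ • p + Real.sin θ • q, Real.cos θ • p + Real.sin θ • q⟫ :=
    mul_nonneg (mul_nonneg hε hr) real_inner_self_nonneg
  simp only [inner_add_left, inner_add_right, real_inner_smul_left, real_inner_smul_right]
    at hn ⊢
  linear_combination hn + e * r * Real.sin_sq_add_cos_sq θ

end

/-- the potential is controlled by the boundary energy. For
a solution on the unit disk and any `0 < r < 1`,
`(1/ε)∫_{D²(r)} V(u_ε) ≤ (r/2)∫_{∂D²(r)} e_ε(u_ε) dℓ`, the boundary circle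
being parametrized by arclength `dℓ = r dθ`. -/
theorem statement_12 (k : ℕ) (hk : 1 ≤ k) (V : Evec k → ℝ) (hV : IsMultiWell V)
    (ε : ℝ) (hε : 0 < ε)
    (u : E2 → Evec k) (hu : IsSolution V ε (ball (0 : E2) 1) u)
    (r : ℝ) (hr0 : 0 < r) (hr1 : r < 1) :
    (1 / ε) * ∫ x in ball (0 : E2) r, V (u x) ≤
      (r / 2) * ∫ θ in (0 : ℝ)..(2 * Real.pi), eDens V ε u (circPt 0 r θ) * r := by
  have hU : IsOpen (ball (0 : E2) 1) := isOpen_ball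
  have hrU : closedBall (0 : E2) r ⊆ ball 0 1 := closedBall_subset_ball hr1
  have hcirc : ∀ θ, circPt 0 r θ ∈ ball (0 : E2) 1 := fun θ => by
    rwa [mem_ball_zero_iff, norm_circPt_zero, abs_of_pos hr0]
  have hcc : Continuous fun θ : ℝ => circPt 0 r θ :=
    (continuous_circPt 0).comp (by fun_prop : Continuous fun θ : ℝ => (r, θ))
  have hcomp : ∀ F : E2 → ℝ, ContDiffOn ℝ 1 F (ball 0 1) →
      Continuous fun θ : ℝ => F (circPt 0 r θ) := fun F hF =>
    hF.continuousOn.comp_continuous hcc hcirc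
  have hT := contDiffOn_stressPos (ε := ε) hV.smooth hU hu.1
  have he : Continuous fun θ : ℝ => eDens V ε u (circPt 0 r θ) * r :=
    (hcomp _ (contDiffOn_eDens hV.smooth hU hu.1)).mul continuous_const
  have hdiv := setIntegral_ball_divergence hU hr0 hrU (hT 0) (hT 1)
  rw [setIntegral_congr_fun measurableSet_ball fun x hx =>
    div_stressPos hV.smooth hU hε.ne' hu (hrU (ball_subset_closedBall hx)),
    integral_const_mul, intervalIntegral.integral_const_mul] at hdiv
  have hle : ∫ θ in (-Real.pi)..Real.pi, (stressPos V ε u 0 (circPt 0 r θ) * Real.cos θ +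
      stressPos V ε u 1 (circPt 0 r θ) * Real.sin θ) ≤
      ∫ θ in (-Real.pi)..Real.pi, eDens V ε u (circPt 0 r θ) * r :=
    intervalIntegral.integral_mono_on (by linarith [Real.pi_pos])
      ((((hcomp _ (hT 0)).mul Real.continuous_cos).add
        ((hcomp _ (hT 1)).mul Real.continuous_sin)).intervalIntegrable _ _)
      (he.intervalIntegrable _ _) fun θ _ => stressPos_normal_le hε.le hr0.le θ
  have hper : Function.Periodic (fun θ : ℝ => eDens V ε u (circPt 0 r θ) * r)
      (2 * Real.pi) := fun θ => by simp [circPt]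
  have hshift := hper.intervalIntegral_add_eq (-Real.pi) 0
  rw [show -Real.pi + 2 * Real.pi = Real.pi by ring, zero_add] at hshift
  rw [hshift] at hle
  rw [one_div]
  linarith [mul_le_mul_of_nonneg_left hle hr0.le]
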